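/- Every finite generating set X of an abelian group G has the falsification by fellow traveler property: there is a constant k > 0 such that every non-geodesic word over X^{±1} is synchronously k-fellow traveled by a shorter word representing the same element. -/

import Mathlib

/-!  Common framework: words over an inverse-closed generating set, word length,
geodesics, falsification by fellow traveler property, almost convexity. -/

namespace ACPaper

variable {β G : Type*} [Group G]

/-- A letter is a generator (`Sum.inl`) or the formal inverse of a generator (`Sum.inr`);
this realizes the inverse-closed alphabet `X^{±1}`. -/
def letterEval (gen : β → G) : β ⊕ β → G :=
  Sum.elim gen fun b => (gen b)⁻¹

/-- Evaluation of a word over `X^{±1}` in the group. -/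
def eval (gen : β → G) (w : List (β ⊕ β)) : G :=
  (w.map (letterEval gen)).prod

/-- `gen` is a generating set: every element is represented by some word. -/
def Generates (gen : β → G) : Prop :=
  ∀ g : G, ∃ w : List (β ⊕ β), eval gen w = g

/-- Word length of a group element with respect to the generating set. -/
noncomputable def wlen (gen : β → G) (g : G) : ℕ :=
  sInf {n : ℕ | ∃ w : List (β ⊕ β), eval gen w = g ∧ w.length = n}

/-- A word is geodesic if its length equals the word length of the element it represents. -/
def IsGeodesic (gen : β → G) (w : List (β ⊕ β)) : Prop :=
  w.length = wlen gen (eval gen w)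

/-- The point reached after `t` steps along the unit-speed path labelled by `w`
(the path remains at its endpoint after time `w.length`). -/
def pos (gen : β → G) (w : List (β ⊕ β)) (t : ℕ) : G :=
  eval gen (w.take t)

/-- Synchronous falsification by fellow traveler property with constant `k`:
every non-geodesic word is synchronously `k`-fellow traveled by a shorter word
representing the same element. -/
def SynchFFTP (gen : β → G) (k : ℕ) : Prop :=
  ∀ w : List (β ⊕ β), ¬ IsGeodesic gen w →
    ∃ w' : List (β ⊕ β), eval gen w' = eval gen w ∧ w'.length < w.length ∧
      ∀ t : ℕ, wlen gen ((pos gen w t)⁻¹ * pos gen w' t) ≤ k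

/-- The path starting at `g` labelled by the word `w` stays in the ball of radius `N`
about the identity. -/
def PathInBall (gen : β → G) (N : ℕ) (g : G) (w : List (β ⊕ β)) : Prop :=
  ∀ t : ℕ, wlen gen (g * pos gen w t) ≤ N

/-- Almost convexity with constant `C`: any two elements of the sphere of radius `N ≥ 1`
at distance at most `2` are joined by a path of length at most `C` inside the ball of
radius `N`. -/
def AlmostConvexWith (gen : β → G) (C : ℕ) : Prop :=
  ∀ N : ℕ, 1 ≤ N → ∀ g g' : G, wlen gen g = N → wlen gen g' = N →
    wlen gen (g⁻¹ * g') ≤ 2 →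
    ∃ w : List (β ⊕ β), g * eval gen w = g' ∧ w.length ≤ C ∧ PathInBall gen N g w

/-- Almost convexity: almost convex with some positive constant. -/
def AlmostConvex (gen : β → G) : Prop :=
  ∃ C : ℕ, 0 < C ∧ AlmostConvexWith gen C


/-- Dickson's lemma for multisets over a finite alphabet. -/
theorem wellQuasiOrderedLE_multiset (A : Type*) [Finite A] :
    WellQuasiOrderedLE (Multiset A) := by
  classical
  refine ⟨fun f => ?_⟩
  obtain ⟨m, n, hmn, h⟩ := wellQuasiOrdered_le (fun i (a : A) => (f i).count a)
  exact ⟨m, n, hmn, Multiset.le_iff_count.2 h⟩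

/-- A subset of a well-quasi-order has a finite subset of elements bounding all others below. -/
theorem exists_finite_basis {α : Type*} [PartialOrder α] [WellQuasiOrderedLE α] (S : Set α) :
    ∃ T : Set α, T.Finite ∧ T ⊆ S ∧ ∀ s ∈ S, ∃ t ∈ T, t ≤ s := by
  refine ⟨{x | Minimal (· ∈ S) x}, ?_, fun x hx => hx.prop, fun s hs => ?_⟩
  · exact WellQuasiOrderedLE.finite_of_isAntichain (setOfPred_minimal_antichain (· ∈ S))
  · obtain ⟨t, hts, ht⟩ := exists_minimal_le_of_wellFoundedLT (· ∈ S) s hs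
    exact ⟨t, ht, hts⟩

theorem exists_sublist_perm_append {A : Type*} {l w : List A} (h : l.Sublist w) :
    ∃ r : List A, r.Sublist w ∧ (l ++ r).Perm w := by
  induction h with
  | slnil => exact ⟨[], List.Sublist.refl _, List.Perm.refl _⟩
  | cons a _ ih =>
    obtain ⟨r, hr, hp⟩ := ih
    exact ⟨a :: r, hr.cons_cons a, List.perm_middle.trans (hp.cons a)⟩
  | cons_cons a _ ih =>
    obtain ⟨r, hr, hp⟩ := ih
    exact ⟨r, hr.cons a, hp.cons a⟩

section Words

variable {β G : Type*}

theorem wlen_eval_le [Group G] (gen : β → G) (w : List (β ⊕ β)) :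
    wlen gen (eval gen w) ≤ w.length :=
  Nat.sInf_le ⟨w, rfl, rfl⟩

theorem exists_word [Group G] {gen : β → G} (hgen : Generates gen) (g : G) :
    ∃ w : List (β ⊕ β), eval gen w = g ∧ w.length = wlen gen g := by
  obtain ⟨w, hw⟩ := hgen g
  exact Nat.sInf_mem (s := {n | ∃ w : List (β ⊕ β), eval gen w = g ∧ w.length = n})
    ⟨w.length, w, hw, rfl⟩

theorem eval_append [Group G] (gen : β → G) (v w : List (β ⊕ β)) :
    eval gen (v ++ w) = eval gen v * eval gen w := by
  simp [eval]

theorem eval_cons [Group G] (gen : β → G) (a : β ⊕ β) (w : List (β ⊕ β)) :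
    eval gen (a :: w) = letterEval gen a * eval gen w := by
  simp [eval]

theorem letterEval_swap [Group G] (gen : β → G) (a : β ⊕ β) :
    letterEval gen a.swap = (letterEval gen a)⁻¹ := by
  cases a <;> simp [letterEval]

theorem wlen_mul_le [Group G] {gen : β → G} (hgen : Generates gen) (g h : G) :
    wlen gen (g * h) ≤ wlen gen g + wlen gen h := by
  obtain ⟨v, rfl, hv⟩ := exists_word hgen g
  obtain ⟨w, rfl, hw⟩ := exists_word hgen h
  rw [← eval_append, ← hv, ← hw, ← List.length_append]
  exact wlen_eval_le gen _

theorem eval_eq_prod_coe [CommGroup G] (gen : β → G) (w : List (β ⊕ β)) :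
    eval gen w = ((w : Multiset (β ⊕ β)).map (letterEval gen)).prod := by
  simp [eval]

/-- In an abelian group, prepending a letter moves each point of a path by at most `2`. -/
theorem wlen_pos_cons_le [CommGroup G] (gen : β → G) (a : β ⊕ β) (w : List (β ⊕ β)) (t : ℕ) :
    wlen gen ((pos gen (a :: w) t)⁻¹ * pos gen w t) ≤ 2 := by
  cases t with
  | zero => simpa [pos, eval] using (wlen_eval_le gen []).trans (Nat.zero_le 2)
  | succ t =>
    have h : (pos gen (a :: w) (t + 1))⁻¹ * pos gen w (t + 1) =
        eval gen (a.swap :: w[t]?.toList) := by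
      rw [pos, pos, List.take_succ_cons, List.take_add_one, eval_append, eval_cons, eval_cons,
        letterEval_swap, mul_inv, mul_assoc, inv_mul_cancel_left]
    rw [h]
    refine (wlen_eval_le gen _).trans ?_
    cases w[t]? <;> simp

/-- In an abelian group, deleting letters from a word moves each point of its path by at most
twice the number of deleted letters. -/
theorem wlen_pos_sublist_le [CommGroup G] {gen : β → G} (hgen : Generates gen)
    {r w : List (β ⊕ β)} (h : r.Sublist w) (t : ℕ) :
    wlen gen ((pos gen w t)⁻¹ * pos gen r t) ≤ 2 * (w.length - r.length) := by
  induction h generalizing t with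
  | slnil => simpa [pos, eval] using wlen_eval_le gen []
  | @cons r w a h ih =>
    have hmul := wlen_mul_le hgen ((pos gen (a :: w) t)⁻¹ * pos gen w t)
      ((pos gen w t)⁻¹ * pos gen r t)
    rw [mul_assoc, mul_inv_cancel_left] at hmul
    have hcons := wlen_pos_cons_le gen a w t
    have hle := h.length_le
    have := ih t
    rw [List.length_cons]
    omega
  | @cons_cons r w a h ih =>
    cases t with
    | zero => simpa [pos, eval] using (wlen_eval_le gen []).trans (Nat.zero_le _)
    | succ t =>
      simpa [pos, eval_cons, mul_assoc, mul_comm, mul_left_comm] using ih t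

end Words

/-- Every finite (inverse-closed) generating set of an abelian group has
the synchronous falsification by fellow traveler property. -/
theorem abelian_fftp {β G : Type*} [CommGroup G] [Fintype β]
    (gen : β → G) (hgen : Generates gen) :
    ∃ k : ℕ, 0 < k ∧ SynchFFTP gen k := by
  have := wellQuasiOrderedLE_multiset (β ⊕ β)
  obtain ⟨T, hfin, hTS, hT⟩ := exists_finite_basis
    {p : Multiset (β ⊕ β) × Multiset (β ⊕ β) |
      (p.1.map (letterEval gen)).prod = (p.2.map (letterEval gen)).prod ∧
        p.2.card < p.1.card}
  obtain ⟨K, hK⟩ := (hfin.image fun p => p.1.card).bddAbove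
  refine ⟨3 * K + 1, by omega, fun w hw => ?_⟩
  obtain ⟨v, hv, hvlen⟩ := exists_word hgen (eval gen w)
  have hvw : v.length < w.length := by
    rw [hvlen]
    exact lt_of_le_of_ne (wlen_eval_le gen w) (Ne.symm hw)
  obtain ⟨⟨a, b⟩, hab, haw, -⟩ := hT (↑w, ↑v)
    ⟨by rw [← eval_eq_prod_coe, ← eval_eq_prod_coe, hv], by simpa using hvw⟩
  obtain ⟨hprod, hcard⟩ := hTS hab
  have haK : a.card ≤ K := hK ⟨(a, b), hab, rfl⟩
  induction a using Quotient.inductionOn with | _ a => ?_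
  induction b using Quotient.inductionOn with | _ b => ?_
  obtain ⟨l, hla, hlw⟩ : List.Subperm a w := haw
  obtain ⟨r, hrw, hperm⟩ := exists_sublist_perm_append hlw
  simp only [Multiset.quot_mk_to_coe, Multiset.coe_card, ← eval_eq_prod_coe] at hprod hcard haK
  have hl : eval gen l = eval gen a := (hla.map _).prod_eq
  have hw' : eval gen l * eval gen r = eval gen w := by
    rw [← eval_append]
    exact (hperm.map _).prod_eq
  have hlen := hperm.length_eq
  rw [List.length_append, hla.length_eq] at hlen
  refine ⟨r ++ b, ?_, ?_, fun t => ?_⟩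
  · rw [eval_append, ← hprod, ← hl, mul_comm, hw']
  · rw [List.length_append]
    omega
  · have hpos : pos gen (r ++ b) t = pos gen r t * eval gen (b.take (t - r.length)) := by
      rw [pos, List.take_append, eval_append, pos]
    have hmul := wlen_mul_le hgen ((pos gen w t)⁻¹ * pos gen r t)
      (eval gen (b.take (t - r.length)))
    have hsub := wlen_pos_sublist_le hgen hrw t
    have htail := (wlen_eval_le gen (b.take (t - r.length))).trans (List.length_take_le' _ _)
    rw [hpos, ← mul_assoc]
    omega

end ACPaper
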